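/- Let (u_z)_{z∈ℂ} be an analytic unitary representation on A. Then for every z ∈ ℂ the element u_z is invertible in A, with inverse u_{-z}. -/

import Mathlib

open scoped ComplexOrder

/-- An analytic unitary representation on a unital complex `*`-algebra `A` : a family
`(u z)_{z ∈ ℂ}` of elements of `A` such that `u t` is unitary for every real `t`, the real
group law holds, and the functions `z ↦ φ (a * u z)` and `z ↦ φ (u z * a)` are entire. -/
structure AnalyticUnitaryRep {A : Type*} [Ring A] [Algebra ℂ A] [StarRing A]
    [StarModule ℂ A] (φ : A →ₗ[ℂ] ℂ) (u : ℂ → A) : Prop where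
  real_unitary : ∀ t : ℝ, star (u (t : ℂ)) * u (t : ℂ) = 1 ∧ u (t : ℂ) * star (u (t : ℂ)) = 1
  real_group : ∀ s t : ℝ, u ((s : ℂ) + (t : ℂ)) = u (s : ℂ) * u (t : ℂ)
  entire_left : ∀ a : A, Differentiable ℂ fun z : ℂ => φ (a * u z)
  entire_right : ∀ a : A, Differentiable ℂ fun z : ℂ => φ (u z * a)

/-- Two entire functions that agree on the real line are equal. -/
theorem Differentiable.eq_of_eq_ofReal {f g : ℂ → ℂ} (hf : Differentiable ℂ f)
    (hg : Differentiable ℂ g) (h : ∀ t : ℝ, f t = g t) : f = g := by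
  refine AnalyticOnNhd.eq_of_frequently_eq (z₀ := 0) (fun z _ => hf.analyticAt z)
    (fun z _ => hg.analyticAt z) ?_
  have key : Filter.Tendsto (fun t : ℝ => (t : ℂ)) (nhdsWithin 0 {0}ᶜ) (nhdsWithin 0 {0}ᶜ) := by
    refine tendsto_nhdsWithin_iff.2 ⟨?_, ?_⟩
    · exact (Complex.continuous_ofReal.tendsto' 0 0 Complex.ofReal_zero).mono_left
        nhdsWithin_le_nhds
    · filter_upwards [self_mem_nhdsWithin] with t ht
      simpa using ht
  exact key.frequently (Filter.Frequently.of_forall h)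

namespace AnalyticUnitaryRep

variable {A : Type*} [Ring A] [Algebra ℂ A] [StarRing A] [StarModule ℂ A]
  {φ : A →ₗ[ℂ] ℂ} {u : ℂ → A}

theorem map_zero (hu : AnalyticUnitaryRep φ u) : u 0 = 1 := by
  have h₁ : u 0 = u 0 * u 0 := by simpa using hu.real_group 0 0
  have h₂ : star (u 0) * u 0 = 1 := by simpa using (hu.real_unitary 0).1
  calc u 0 = star (u 0) * u 0 * u 0 := by rw [h₂, one_mul]
    _ = star (u 0) * u 0 := by rw [mul_assoc, ← h₁]
    _ = 1 := h₂

theorem map_add_ofReal (hu : AnalyticUnitaryRep φ u)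
    (hfaith : ∀ a : A, φ (star a * a) = 0 → a = 0) (w : ℂ) (t : ℝ) :
    u (w + t) = u w * u t := by
  have h : ∀ a : A, φ (u (w + t) * a) = φ (u w * u t * a) := fun a => by
    have := Differentiable.eq_of_eq_ofReal
      (f := fun z => φ (u (z + t) * a)) (g := fun z => φ (u z * (u t * a)))
      ((hu.entire_right a).comp (differentiable_id.add_const (t : ℂ)))
      (hu.entire_right (u t * a))
      (fun s => by simp only [hu.real_group s t, mul_assoc])
    simpa only [mul_assoc] using congrFun this w
  refine sub_eq_zero.1 (star_eq_zero.1 (hfaith _ ?_))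
  rw [star_star, sub_mul, map_sub, h, sub_self]

/-- The group law of an analytic unitary representation extends to complex parameters. -/
theorem map_add (hu : AnalyticUnitaryRep φ u)
    (hfaith : ∀ a : A, φ (star a * a) = 0 → a = 0) (w z : ℂ) :
    u (w + z) = u w * u z := by
  have h : ∀ a : A, φ (a * u (w + z)) = φ (a * (u w * u z)) := fun a => by
    have := Differentiable.eq_of_eq_ofReal
      (f := fun z => φ (a * u (w + z))) (g := fun z => φ (a * u w * u z))
      ((hu.entire_left a).comp (differentiable_id.const_add w))
      (hu.entire_left (a * u w))
      (fun t => by simp only [hu.map_add_ofReal hfaith w t, mul_assoc])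
    simpa only [mul_assoc] using congrFun this z
  refine sub_eq_zero.1 (hfaith _ ?_)
  rw [mul_sub, map_sub, h, sub_self]

end AnalyticUnitaryRep

/-- Every `u z` of an analytic unitary representation is invertible in `A`,
with inverse `u (-z)`. -/
theorem analyticUnitaryRep_invertible {A : Type*} [Ring A] [Algebra ℂ A] [StarRing A] [StarModule ℂ A]
    (φ : A →ₗ[ℂ] ℂ)
    (hpos : ∀ a : A, 0 ≤ φ (star a * a))
    (hfaith : ∀ a : A, φ (star a * a) = 0 → a = 0)
    (u : ℂ → A) (hu : AnalyticUnitaryRep φ u)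
    (z : ℂ) :
    IsUnit (u z) ∧ u z * u (-z) = 1 ∧ u (-z) * u z = 1 := by
  have h₁ : u z * u (-z) = 1 := by
    rw [← hu.map_add hfaith, add_neg_cancel, hu.map_zero]
  have h₂ : u (-z) * u z = 1 := by
    rw [← hu.map_add hfaith, neg_add_cancel, hu.map_zero]
  exact ⟨⟨⟨u z, u (-z), h₁, h₂⟩, rfl⟩, h₁, h₂⟩
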